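/- If φ is a C² convex function on an open subset of C^n ≅ R^{2n}, then at every point (det_C(2 φ_{k̄ j}))^{1/n} ≥ (det_R(D²φ))^{1/(2n)}; that is, the n-th root of the complex Monge–Ampère operator dominates the 2n-th root of the real Monge–Ampère operator. -/

import Mathlib

open Matrix

noncomputable section

/-- The real coordinate directions `∂/∂x^j` (i.e. `e_j`) and `∂/∂y^j`
(i.e. `i e_j`) in `ℂ^n ≅ ℝ^{2n}`. -/
def rDir {n : ℕ} : (Fin n ⊕ Fin n) → EuclideanSpace ℂ (Fin n) :=
  Sum.elim (fun j => EuclideanSpace.single j (1 : ℂ))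
    (fun j => EuclideanSpace.single j (Complex.I))

/-- Second directional derivative `D²φ(a,b)`. -/
def hess2 {n : ℕ} (φ : EuclideanSpace ℂ (Fin n) → ℝ)
    (z a b : EuclideanSpace ℂ (Fin n)) : ℝ :=
  fderiv ℝ (fun w => fderiv ℝ φ w b) z a

/-- The real Hessian matrix `D²φ` of `φ` at `z`. -/
def realHessian {n : ℕ} (φ : EuclideanSpace ℂ (Fin n) → ℝ)
    (z : EuclideanSpace ℂ (Fin n)) : Matrix (Fin n ⊕ Fin n) (Fin n ⊕ Fin n) ℝ :=
  fun i i' => hess2 φ z (rDir i) (rDir i')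

/-- The complex Hessian matrix `(2 ∂²φ/∂z̄^k∂z^j)` of `φ` at `z`. -/
def cxHessian (n : ℕ) (φ : EuclideanSpace ℂ (Fin n) → ℝ)
    (z : EuclideanSpace ℂ (Fin n)) : Matrix (Fin n) (Fin n) ℂ :=
  fun j k => (1 / 2 : ℂ) *
    (((hess2 φ z (rDir (Sum.inl j)) (rDir (Sum.inl k))
        + hess2 φ z (rDir (Sum.inr j)) (rDir (Sum.inr k)) : ℝ) : ℂ)
      + Complex.I * ((hess2 φ z (rDir (Sum.inl j)) (rDir (Sum.inr k))
        - hess2 φ z (rDir (Sum.inr j)) (rDir (Sum.inl k)) : ℝ) : ℂ))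

open scoped MatrixOrder in
lemma aux_factor {m : Type*} [Fintype m] [DecidableEq m] {H : Matrix m m ℝ}
    (hH : H.PosSemidef) : ∃ B : Matrix m m ℝ, H = Bᴴ * B := by
  obtain ⟨y, hy⟩ := CStarAlgebra.nonneg_iff_eq_star_mul_self.mp hH.nonneg
  exact ⟨y, hy⟩

lemma aux_det_one_add {m : Type*} [Fintype m] [DecidableEq m] {N : Matrix m m ℝ}
    (hN : N.PosSemidef) : 4 ^ Fintype.card m * N.det ≤ (1 + N).det ^ 2 := by
  have h1 : (1 + N).det ^ 2 = ∏ i, (1 + hN.1.eigenvalues i) ^ 2 := by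
    have h := congrArg (Polynomial.eval (-1)) hN.1.charpoly_eq
    rw [Matrix.eval_charpoly, Polynomial.eval_prod] at h
    have h2 : (Matrix.scalar m) (-1 : ℝ) - N = -(1 + N) := by
      have : (Matrix.scalar m) (-1 : ℝ) = -1 := by rw [map_neg, map_one]
      rw [this, neg_add, sub_eq_add_neg]
    rw [h2, Matrix.det_neg] at h
    have h3 := congrArg (fun x => x ^ 2) h
    simp only [mul_pow] at h3
    rw [← pow_mul, mul_comm _ 2, pow_mul, neg_one_sq, one_pow, one_mul] at h3
    rw [h3, ← Finset.prod_pow]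
    refine Finset.prod_congr rfl fun i _ => ?_
    simp
    ring
  rw [h1, hN.1.det_eq_prod_eigenvalues, ← Finset.card_univ, ← Finset.prod_const,
    ← Finset.prod_mul_distrib]
  refine Finset.prod_le_prod (fun i _ => ?_) (fun i _ => ?_)
  · have := hN.eigenvalues_nonneg i
    simp only [RCLike.ofReal_real_eq_id, id]
    positivity
  · simp only [RCLike.ofReal_real_eq_id, id]
    nlinarith [sq_nonneg (1 - hN.1.eigenvalues i)]

lemma aux_det_add {m : Type*} [Fintype m] [DecidableEq m] {H K : Matrix m m ℝ}
    (hH : H.PosSemidef) (hd : H.det ≠ 0) (hK : K.PosSemidef) :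
    4 ^ Fintype.card m * (H.det * K.det) ≤ (H + K).det ^ 2 := by
  obtain ⟨B, rfl⟩ := aux_factor hH
  have hB : IsUnit B.det := by
    rw [isUnit_iff_ne_zero]
    rintro h
    simp [h] at hd
  have hBt : IsUnit (Bᴴ).det := by simpa using hB
  set N := (B⁻¹)ᴴ * K * B⁻¹ with hNdef
  have hN : N.PosSemidef := hK.conjTranspose_mul_mul_same _
  have hKN : K = Bᴴ * N * B := by
    rw [hNdef, Matrix.conjTranspose_nonsing_inv]
    simp only [Matrix.mul_assoc]
    rw [Matrix.nonsing_inv_mul _ hB, Matrix.mul_one, Matrix.mul_nonsing_inv_cancel_left _ _ hBt]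
  have hs : Bᴴ * B + K = Bᴴ * (1 + N) * B := by
    rw [hKN]; simp [Matrix.mul_add, Matrix.add_mul]
  rw [hs, hKN]
  simp only [Matrix.det_mul, Matrix.det_conjTranspose, star_trivial]
  have := mul_le_mul_of_nonneg_left (aux_det_one_add hN) (by positivity : 0 ≤ B.det ^ 4)
  linarith

lemma aux_block {n : ℕ} (P Q : Matrix (Fin n) (Fin n) ℂ) :
    (Matrix.fromBlocks P Q (-Q) P).det =
      (P - Complex.I • Q).det * (P + Complex.I • Q).det := by
  have h : Matrix.fromBlocks 1 (Complex.I • (1 : Matrix (Fin n) (Fin n) ℂ)) 0 1 *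
      Matrix.fromBlocks P Q (-Q) P *
      Matrix.fromBlocks 1 (-Complex.I • (1 : Matrix (Fin n) (Fin n) ℂ)) 0 1
      = Matrix.fromBlocks (P - Complex.I • Q) 0 (-Q) (P + Complex.I • Q) := by
    rw [Matrix.fromBlocks_multiply, Matrix.fromBlocks_multiply]
    congr 1
    · simp [sub_eq_add_neg]
    · simp [smul_add, smul_smul]
      abel
    · simp
    · simp [add_comm]
  have h2 := congrArg Matrix.det h
  rw [Matrix.det_mul, Matrix.det_mul, Matrix.det_fromBlocks_zero₂₁, Matrix.det_fromBlocks_zero₂₁,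
    Matrix.det_fromBlocks_zero₁₂] at h2
  simpa using h2

/-- Complexification of a real `2n × 2n` matrix. -/
def aux_cx {n : ℕ} (H : Matrix (Fin n ⊕ Fin n) (Fin n ⊕ Fin n) ℝ) : Matrix (Fin n) (Fin n) ℂ :=
  fun j k => (1 / 2 : ℂ) *
    (((H (Sum.inl j) (Sum.inl k) + H (Sum.inr j) (Sum.inr k) : ℝ) : ℂ)
      + Complex.I * ((H (Sum.inl j) (Sum.inr k) - H (Sum.inr j) (Sum.inl k) : ℝ) : ℂ))

open scoped ComplexOrder in
lemma aux_cx_psd {n : ℕ} {H : Matrix (Fin n ⊕ Fin n) (Fin n ⊕ Fin n) ℝ}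
    (hH : H.PosSemidef) : (aux_cx H).PosSemidef := by
  obtain ⟨B, hB⟩ := aux_factor hH
  have hc : (H.map ((↑) : ℝ → ℂ)).PosSemidef := by
    have : H.map ((↑) : ℝ → ℂ) = (B.map ((↑) : ℝ → ℂ))ᴴ * B.map ((↑) : ℝ → ℂ) := by
      rw [hB]
      ext i j
      simp [Matrix.mul_apply]
    rw [this]
    exact Matrix.posSemidef_conjTranspose_mul_self _
  let W : Matrix (Fin n ⊕ Fin n) (Fin n) ℂ :=
    Matrix.fromRows 1 (Complex.I • (1 : Matrix (Fin n) (Fin n) ℂ))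
  have h1 : aux_cx H = (1 / 2 : ℝ) • (Wᴴ * H.map ((↑) : ℝ → ℂ) * W) := by
    ext j k
    simp [aux_cx, W, Matrix.mul_apply, Matrix.fromRows_apply_inl, Matrix.fromRows_apply_inr,
      Matrix.one_apply, apply_ite (starRingEnd ℂ)]
    ring_nf
    simp
    ring
  rw [h1]
  exact (hc.conjTranspose_mul_mul_same W).smul (by norm_num)

open scoped ComplexOrder in
lemma aux_main {n : ℕ} {H : Matrix (Fin n ⊕ Fin n) (Fin n ⊕ Fin n) ℝ}
    (hH : H.PosSemidef) : 0 ≤ (aux_cx H).det.re ∧ H.det ≤ (aux_cx H).det.re ^ 2 := by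
  have hpos := (aux_cx_psd hH).det_nonneg
  have hre : 0 ≤ (aux_cx H).det.re := (Complex.le_def.mp hpos).1
  have him : ((aux_cx H).det.re : ℂ) = (aux_cx H).det := by
    apply Complex.ext
    · simp
    · simpa using (Complex.le_def.mp hpos).2
  refine ⟨hre, ?_⟩
  by_cases hd : H.det = 0
  · rw [hd]; positivity
  set r := (aux_cx H).det.re with hr
  let J : Matrix (Fin n ⊕ Fin n) (Fin n ⊕ Fin n) ℝ := Matrix.fromBlocks 0 (-1) 1 0
  have hJ : Jᴴ * J = 1 := by
    simp [J, Matrix.fromBlocks_transpose, Matrix.fromBlocks_multiply]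
  have hJd : J.det * J.det = 1 := by
    have := congrArg Matrix.det hJ
    simpa using this
  have hK := hH.conjTranspose_mul_mul_same J
  have hKd : (Jᴴ * H * J).det = H.det := by
    simp only [Matrix.det_mul, Matrix.det_conjTranspose, star_trivial]
    linear_combination H.det * hJd
  have key := aux_det_add hH hd hK
  have hdet : (H + Jᴴ * H * J).det = (2 ^ n * r) ^ 2 := by
    have hsum : (H + Jᴴ * H * J) = Matrix.fromBlocks (H.toBlocks₁₁ + H.toBlocks₂₂)
        (H.toBlocks₁₂ - H.toBlocks₂₁) (-(H.toBlocks₁₂ - H.toBlocks₂₁))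
        (H.toBlocks₁₁ + H.toBlocks₂₂) := by
      conv_lhs => rw [← Matrix.fromBlocks_toBlocks H]
      simp [J, Matrix.fromBlocks_transpose, Matrix.fromBlocks_multiply, Matrix.fromBlocks_add,
        sub_eq_add_neg, add_comm]
    set P := (H.toBlocks₁₁ + H.toBlocks₂₂).map ((↑) : ℝ → ℂ) with hP
    set Q := (H.toBlocks₁₂ - H.toBlocks₂₁).map ((↑) : ℝ → ℂ) with hQ
    have h2 : P + Complex.I • Q = (2 : ℂ) • aux_cx H := by
      ext j k
      simp [P, Q, aux_cx, Matrix.toBlocks₁₁, Matrix.toBlocks₁₂, Matrix.toBlocks₂₁,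
        Matrix.toBlocks₂₂]
    have hs := hH.1
    have h3 : P - Complex.I • Q = (P + Complex.I • Q)ᵀ := by
      ext j k
      have e : ∀ a b, H a b = H b a := fun a b => by simpa using (hs.apply a b).symm
      simp [P, Q, Matrix.toBlocks₁₁, Matrix.toBlocks₁₂, Matrix.toBlocks₂₁,
        Matrix.toBlocks₂₂]
      rw [e (Sum.inl k) (Sum.inl j), e (Sum.inr k) (Sum.inr j), e (Sum.inl k) (Sum.inr j),
        e (Sum.inr k) (Sum.inl j)]
      ring
    have h4 := aux_block P Q
    rw [h3, Matrix.det_transpose, h2, Matrix.det_smul, ← him] at h4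
    have h5 : ((H + Jᴴ * H * J).det : ℂ) = (Matrix.fromBlocks P Q (-Q) P).det := by
      have := RingHom.map_det Complex.ofRealHom (H + Jᴴ * H * J)
      rw [Complex.ofRealHom_eq_coe] at this
      rw [this, hsum]
      congr 1
      ext i j
      rcases i with i | i <;> rcases j with j | j <;> simp [P, Q]
    rw [h4] at h5
    simp only [Fintype.card_fin] at h5
    have h6 : (((H + Jᴴ * H * J).det : ℝ) : ℂ) = (((2 ^ n * r) ^ 2 : ℝ) : ℂ) := by
      rw [h5]; push_cast; ring
    exact_mod_cast h6
  rw [hKd, hdet] at key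
  simp only [Fintype.card_sum, Fintype.card_fin] at key
  have e1 : (4 : ℝ) ^ (n + n) = (2 ^ n) ^ 4 := by
    rw [← pow_mul, show (4 : ℝ) = 2 ^ 2 by norm_num, ← pow_mul]; congr 1; ring
  rw [e1] at key
  have e2 : ((2 : ℝ) ^ n) ^ 4 * H.det ^ 2 ≤ (2 ^ n) ^ 4 * (r ^ 2) ^ 2 := by
    nlinarith
  have e3 : H.det ^ 2 ≤ (r ^ 2) ^ 2 := le_of_mul_le_mul_left e2 (by positivity)
  exact abs_le_of_sq_le_sq' e3 (by positivity) |>.2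

lemma aux_hess {n : ℕ} {U : Set (EuclideanSpace ℂ (Fin n))} (hU : IsOpen U)
    {φ : EuclideanSpace ℂ (Fin n) → ℝ} (hφ : ContDiffOn ℝ 2 φ U)
    {z : EuclideanSpace ℂ (Fin n)} (hz : z ∈ U) (a b : EuclideanSpace ℂ (Fin n)) :
    hess2 φ z a b = fderiv ℝ (fderiv ℝ φ) z a b := by
  have h : ContDiffAt ℝ 2 φ z := hφ.contDiffAt (hU.mem_nhds hz)
  have hd : DifferentiableAt ℝ (fderiv ℝ φ) z :=
    (h.fderiv_right (m := 1) (by norm_num)).differentiableAt (by norm_num)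
  unfold hess2
  rw [fderiv_clm_apply hd (differentiableAt_const b)]
  simp

lemma aux_hess_nonneg {E : Type*} [NormedAddCommGroup E] [NormedSpace ℝ E]
    {U : Set E} (hU : IsOpen U)
    {φ : E → ℝ} (hφ : ContDiffOn ℝ 2 φ U) (hconv : ConvexOn ℝ U φ)
    {z : E} (hz : z ∈ U) (a : E) :
    0 ≤ fderiv ℝ (fderiv ℝ φ) z a a := by
  let L : ℝ →ᵃ[ℝ] E := AffineMap.lineMap z (z + a)
  have hL : ∀ t, L t = z + t • a := fun t => by simp [L, AffineMap.lineMap_apply, add_comm]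
  have hLd : ∀ t, HasDerivAt (fun t : ℝ => z + t • a) a t := fun t => by
    simpa using ((hasDerivAt_id' (𝕜 := ℝ) t).smul_const a).const_add z
  have hg := hconv.comp_affineMap L
  set S := L ⁻¹' U with hS
  have hfun : φ ∘ L = fun t => φ (z + t • a) := by
    funext t; simp [hL]
  rw [hfun] at hg
  have hSo : IsOpen S := by
    have : S = (fun t : ℝ => z + t • a) ⁻¹' U := by ext t; simp [hS, hL]
    rw [this]
    exact hU.preimage (by fun_prop)
  have h0 : (0 : ℝ) ∈ S := by simp [hS, hL, hz]
  have hder : ∀ t ∈ S, HasDerivAt (fun t => φ (z + t • a)) (fderiv ℝ φ (z + t • a) a) t := by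
    intro t ht
    have htU : z + t • a ∈ U := by simpa [hS, hL] using ht
    have h : ContDiffAt ℝ 2 φ (z + t • a) := hφ.contDiffAt (hU.mem_nhds htU)
    exact (h.differentiableAt (by norm_num)).hasFDerivAt.comp_hasDerivAt t (hLd t)
  have hmono : MonotoneOn (fun t => fderiv ℝ φ (z + t • a) a) S := by
    have := hg.monotoneOn_deriv (fun t ht => (hder t ht).differentiableAt)
    exact this.congr (fun t ht => (hder t ht).deriv)
  have h : ContDiffAt ℝ 2 φ z := hφ.contDiffAt (hU.mem_nhds hz)
  have hd : DifferentiableAt ℝ (fderiv ℝ φ) z :=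
    (h.fderiv_right (m := 1) (by norm_num)).differentiableAt (by norm_num)
  have hd' : HasFDerivAt (fderiv ℝ φ) (fderiv ℝ (fderiv ℝ φ) z) (z + (0 : ℝ) • a) := by
    simpa using hd.hasFDerivAt
  have h2 : HasDerivAt (fun t : ℝ => fderiv ℝ φ (z + t • a) a)
      (fderiv ℝ (fderiv ℝ φ) z a a) 0 := by
    have h3 : HasDerivAt (fun t : ℝ => fderiv ℝ φ (z + t • a))
        (fderiv ℝ (fderiv ℝ φ) z a) 0 := hd'.comp_hasDerivAt (0 : ℝ) (hLd 0)
    exact (ContinuousLinearMap.apply ℝ ℝ a).hasFDerivAt.comp_hasDerivAt (0 : ℝ) h3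
  rw [← h2.deriv, ← derivWithin_of_isOpen hSo h0]
  exact hmono.derivWithin_nonneg

lemma aux_real_psd {n : ℕ} {U : Set (EuclideanSpace ℂ (Fin n))} (hU : IsOpen U)
    {φ : EuclideanSpace ℂ (Fin n) → ℝ} (hφ : ContDiffOn ℝ 2 φ U) (hconv : ConvexOn ℝ U φ)
    {z : EuclideanSpace ℂ (Fin n)} (hz : z ∈ U) : (realHessian φ z).PosSemidef := by
  have hr : ∀ i j, realHessian φ z i j = fderiv ℝ (fderiv ℝ φ) z (rDir i) (rDir j) :=
    fun i j => aux_hess hU hφ hz _ _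
  refine Matrix.PosSemidef.of_dotProduct_mulVec_nonneg ?_ ?_
  · ext i j
    have h : ContDiffAt ℝ 2 φ z := hφ.contDiffAt (hU.mem_nhds hz)
    have := h.isSymmSndFDerivAt (by simp) (rDir i) (rDir j)
    simp [hr, this]
  · intro x
    have := aux_hess_nonneg hU hφ hconv hz (∑ i, x i • rDir i)
    refine this.trans_eq ?_
    simp only [map_sum, map_smul, _root_.sum_apply, _root_.smul_apply,
      dotProduct, Matrix.mulVec, hr, star_trivial, smul_eq_mul, Pi.star_apply]
    simp only [Finset.mul_sum]
    rw [Finset.sum_comm]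
    refine Finset.sum_congr rfl fun i _ => ?_
    refine Finset.sum_congr rfl fun j _ => ?_
    ring

/-- If `φ` is a `C²` convex function on an open subset of `ℂ^n ≅ ℝ^{2n}`, then
at every point `(det_ℂ (2 φ_{k̄ j}))^{1/n} ≥ (det_ℝ D²φ)^{1/(2n)}`. -/
theorem cx_MA_ge_real_MA (n : ℕ) (hn : 0 < n)
    (U : Set (EuclideanSpace ℂ (Fin n))) (hU : IsOpen U)
    (φ : EuclideanSpace ℂ (Fin n) → ℝ) (hφ : ContDiffOn ℝ 2 φ U)
    (hconv : ConvexOn ℝ U φ) (z : EuclideanSpace ℂ (Fin n)) (hz : z ∈ U) :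
    ((realHessian φ z).det) ^ ((2 * (n : ℝ))⁻¹)
      ≤ ((cxHessian n φ z).det.re) ^ ((n : ℝ)⁻¹) := by
  obtain ⟨h1, h2⟩ := aux_main (aux_real_psd hU hφ hconv hz)
  have hC : cxHessian n φ z = aux_cx (realHessian φ z) := rfl
  rw [hC]
  have h0 : 0 ≤ (realHessian φ z).det := (aux_real_psd hU hφ hconv hz).det_nonneg
  calc ((realHessian φ z).det) ^ ((2 * (n : ℝ))⁻¹)
      ≤ ((aux_cx (realHessian φ z)).det.re ^ 2) ^ ((2 * (n : ℝ))⁻¹) :=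
        Real.rpow_le_rpow h0 h2 (by positivity)
    _ = ((aux_cx (realHessian φ z)).det.re) ^ ((n : ℝ)⁻¹) := by
        rw [← Real.rpow_natCast, ← Real.rpow_mul h1]
        congr 1
        have : (n : ℝ) ≠ 0 := by positivity
        push_cast
        field_simp

end
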